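/- arXiv:1801.06542 — 3 statements merged into one kernel-verified Lean document; each statement's English description precedes it below -/
import Mathlib

section
/- Let n ≥ 2 be an even integer, let F = GaloisField 2 n, and let L : F → F be a ZMod 2-linear map. Suppose L* : F → F is a ZMod 2-linear map satisfying the adjoint relation Tr(x · L(y)) = Tr(L*(x) · y) for all x, y ∈ F, where Tr is the absolute trace of F. Then the Boolean function f : F → ZMod 2 defined by f(x) = Tr(x · L(x)) is bent if and only if the map x ↦ L(x) + L*(x) is a bijection of F. -/
open Finset

noncomputable instance (n : ℕ) : Fintype (GaloisField 2 n) := Fintype.ofFinite _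

/-- The absolute trace of `GaloisField 2 n` over `ZMod 2`. -/
noncomputable def gTr (n : ℕ) : GaloisField 2 n → ZMod 2 :=
  Algebra.trace (ZMod 2) (GaloisField 2 n)

/-- A Boolean function on `GaloisField 2 n` is bent if all its Walsh values
square to `2^n`. -/
def IsBent {n : ℕ} (f : GaloisField 2 n → ZMod 2) : Prop :=
  ∀ lam : GaloisField 2 n,
    (∑ x : GaloisField 2 n, (-1 : ℤ) ^ (f x + gTr n (lam * x)).val) ^ 2 = 2 ^ n

/-- The nontrivial additive character `ZMod 2 → {1, -1}`. -/
def signChar (a : ZMod 2) : ℤ := (-1) ^ a.val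

lemma signChar_add (a b : ZMod 2) : signChar (a + b) = signChar a * signChar b := by
  revert a b; decide

lemma signChar_ne_zero (a : ZMod 2) : signChar a ≠ 0 := by
  revert a; decide

lemma gTr_add {n : ℕ} (x y : GaloisField 2 n) : gTr n (x + y) = gTr n x + gTr n y :=
  map_add (Algebra.trace (ZMod 2) (GaloisField 2 n)) x y

lemma gTr_zero (n : ℕ) : gTr n 0 = 0 :=
  map_zero (Algebra.trace (ZMod 2) (GaloisField 2 n))

lemma exists_gTr_mul_eq_one {n : ℕ} {c : GaloisField 2 n} (hc : c ≠ 0) :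
    ∃ x, gTr n (c * x) = 1 := by
  by_contra! h
  refine hc ((traceForm_nondegenerate (ZMod 2) (GaloisField 2 n)).1 c fun x => ?_)
  have hx : gTr n (c * x) = 0 := by
    have key : ∀ a : ZMod 2, a ≠ 1 → a = 0 := by decide
    exact key _ (h x)
  simpa [Algebra.traceForm_apply, gTr] using hx

lemma sum_signChar_gTr_mul {n : ℕ} (hn : n ≠ 0) (c : GaloisField 2 n) [Decidable (c = 0)] :
    ∑ x : GaloisField 2 n, signChar (gTr n (c * x)) = if c = 0 then 2 ^ n else 0 := by
  split_ifs with hc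
  · have hcard : Fintype.card (GaloisField 2 n) = 2 ^ n := by
      rw [← Nat.card_eq_fintype_card, GaloisField.card 2 n hn]
    have h0 : signChar 0 = 1 := by decide
    simp [hc, gTr_zero, h0, hcard]
  · obtain ⟨a, ha⟩ := exists_gTr_mul_eq_one hc
    have h := Equiv.sum_comp (Equiv.addRight a) fun x => signChar (gTr n (c * x))
    have h1 : signChar 1 = -1 := by decide
    simp only [Equiv.coe_addRight, mul_add, gTr_add, signChar_add, ha, h1, ← sum_mul] at h
    linarith

section Adjoint

variable {n : ℕ} {L Lstar : GaloisField 2 n →ₗ[ZMod 2] GaloisField 2 n}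

lemma gTr_quadratic_add
    (hadj : ∀ x y : GaloisField 2 n, gTr n (x * L y) = gTr n (Lstar x * y))
    (x a : GaloisField 2 n) :
    gTr n ((a + x) * L (a + x)) =
      gTr n (x * L x) + gTr n (a * L a) + gTr n ((L a + Lstar a) * x) := by
  have h : (a + x) * L (a + x) = x * L x + a * L a + (L a * x + a * L x) := by
    rw [map_add]; ring
  rw [h, gTr_add, gTr_add, gTr_add, hadj a x, add_mul, gTr_add]

open Classical in
/-- The squared Walsh transform of `x ↦ Tr (x * L x)` as a sum over the kernel of `L + L*`. -/
lemma walsh_sq (hn : n ≠ 0)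
    (hadj : ∀ x y : GaloisField 2 n, gTr n (x * L y) = gTr n (Lstar x * y))
    (lam : GaloisField 2 n) :
    (∑ x : GaloisField 2 n, signChar (gTr n (x * L x) + gTr n (lam * x))) ^ 2 =
      2 ^ n * ∑ a : GaloisField 2 n,
        if L a + Lstar a = 0 then signChar (gTr n (a * L a) + gTr n (lam * a)) else 0 := by
  have hself : ∀ a : ZMod 2, signChar a * signChar a = 1 := by decide
  have hshift : ∀ x : GaloisField 2 n,
      ∑ y : GaloisField 2 n, signChar (gTr n (x * L x) + gTr n (lam * x)) *
          signChar (gTr n (y * L y) + gTr n (lam * y)) =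
        ∑ a : GaloisField 2 n, signChar (gTr n (a * L a) + gTr n (lam * a)) *
          signChar (gTr n ((L a + Lstar a) * x)) := by
    intro x
    rw [← Equiv.sum_comp (Equiv.addRight x)]
    refine sum_congr rfl fun a _ => ?_
    simp only [Equiv.coe_addRight, gTr_quadratic_add hadj, mul_add lam, gTr_add (lam * a),
      signChar_add]
    linear_combination (signChar (gTr n (a * L a)) * signChar (gTr n (lam * a)) *
      signChar (gTr n ((L a + Lstar a) * x))) *
      (signChar (gTr n (lam * x)) * signChar (gTr n (lam * x)) * hself (gTr n (x * L x)) +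
        hself (gTr n (lam * x)))
  rw [sq, sum_mul_sum, sum_congr rfl fun x _ => hshift x, sum_comm, mul_sum]
  refine sum_congr rfl fun a _ => ?_
  rw [← mul_sum, sum_signChar_gTr_mul hn]
  split_ifs <;> ring

end Adjoint

theorem stmt_4 (n : ℕ) (hn : 2 ≤ n) (hneven : Even n)
    (L Lstar : GaloisField 2 n →ₗ[ZMod 2] GaloisField 2 n)
    (hadj : ∀ x y : GaloisField 2 n, gTr n (x * L y) = gTr n (Lstar x * y)) :
    IsBent (fun x => gTr n (x * L x)) ↔
      Function.Bijective (fun x => L x + Lstar x) := by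
  classical
  have hn0 : n ≠ 0 := by lia
  have hM : Function.Bijective (fun x => L x + Lstar x) ↔ ∀ a, L a + Lstar a = 0 → a = 0 := by
    rw [← Finite.injective_iff_bijective]
    exact injective_iff_map_eq_zero (L + Lstar)
  have hbent : IsBent (fun x => gTr n (x * L x)) ↔ ∀ lam : GaloisField 2 n,
      (∑ a : GaloisField 2 n, if L a + Lstar a = 0 then
        signChar (gTr n (a * L a) + gTr n (lam * a)) else 0) = 1 := by
    refine forall_congr' fun lam => ?_
    have h := walsh_sq hn0 hadj lam
    simp only [signChar] at h ⊢
    rw [h]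
    exact mul_eq_left₀ (by positivity)
  rw [hM, hbent]
  constructor
  · intro h b hb
    by_contra hb0
    have h1 : ∑ lam : GaloisField 2 n, signChar (gTr n (b * lam)) *
        (∑ a : GaloisField 2 n, if L a + Lstar a = 0 then
          signChar (gTr n (a * L a) + gTr n (lam * a)) else 0) = 0 := by
      simp only [h, mul_one]
      rw [sum_signChar_gTr_mul hn0, if_neg hb0]
    have h2 : ∀ a : GaloisField 2 n, ∑ lam : GaloisField 2 n, signChar (gTr n (b * lam)) *
        (if L a + Lstar a = 0 then signChar (gTr n (a * L a) + gTr n (lam * a)) else 0) =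
        if a = b then 2 ^ n * signChar (gTr n (b * L b)) else 0 := by
      intro a
      by_cases ha : L a + Lstar a = 0
      · have h3 : ∀ lam : GaloisField 2 n, signChar (gTr n (b * lam)) *
            signChar (gTr n (a * L a) + gTr n (lam * a)) =
            signChar (gTr n (a * L a)) * signChar (gTr n ((a + b) * lam)) := by
          intro lam
          rw [add_mul, gTr_add, signChar_add, signChar_add, mul_comm lam a]
          ring
        simp only [if_pos ha, h3, ← mul_sum]
        rw [sum_signChar_gTr_mul hn0, ← CharTwo.sub_eq_add]
        simp only [sub_eq_zero]
        split_ifs with hab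
        · rw [hab, mul_comm]
        · simp
      · have hab : a ≠ b := fun hab => ha (hab ▸ hb)
        simp [ha, hab]
    simp only [mul_sum] at h1
    rw [sum_comm, sum_congr rfl fun a _ => h2 a, sum_ite_eq' univ b, if_pos (mem_univ b)] at h1
    exact mul_ne_zero (by positivity) (signChar_ne_zero _) h1
  · intro h lam
    rw [sum_eq_single 0]
    · simp [gTr_zero, signChar]
    · intro a _ ha
      exact if_neg fun h0 => ha (h a h0)
    · simp
end

section
/- Let k ≥ 1, let F = GaloisField 2 (2k), and let G : F → F be any function such that for every β ∈ F with β^{2^k} ≠ β, the Boolean function x ↦ Tr(β G(x)) is bent. Then for every α ∈ F with α^{2^k} ≠ α, the map x ↦ α G(x) + (α G(x))^{2^k} from F to the subfield F_{2^k} is a vectorial bent function; that is, for every nonzero λ in the subfield F_{2^k}, the Boolean function x ↦ Tr(λ α G(x)) is bent. -/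
open Finset

theorem stmt_11 (k : ℕ) (hk : 1 ≤ k) (G : GaloisField 2 (2 * k) → GaloisField 2 (2 * k))
    (hG : ∀ β : GaloisField 2 (2 * k), β ^ 2 ^ k ≠ β →
      IsBent (fun x => gTr (2 * k) (β * G x)))
    (α : GaloisField 2 (2 * k)) (hα : α ^ 2 ^ k ≠ α) :
    ∀ lam : GaloisField 2 (2 * k), lam ^ 2 ^ k = lam → lam ≠ 0 →
      IsBent (fun x => gTr (2 * k) (lam * (α * G x))) := by
  intro lam hlam hlam0
  have h_not_fixed : (lam * α) ^ 2 ^ k ≠ lam * α := by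
    rw [mul_pow, hlam]
    exact fun h => hα (mul_left_cancel₀ hlam0 h)
  simpa only [mul_assoc] using hG (lam * α) h_not_fixed
end

section
/- Let k ≥ 1, let F = GaloisField 2 (2k), let i ≥ 0 and ρ be integers with 1 ≤ ρ ≤ k, let t1, …, tρ be integers with 0 ≤ tj ≤ k, and let γ1, …, γρ be elements of the subfield F_{2^k}. Assume that the only z ∈ F_{2^k} with ∑_{j=1}^{ρ} γj^{2^{k−tj}} z^{2^{k−tj}} + z = 0 is z = 0, and the only z ∈ F_{2^k} with ∑_{j=1}^{ρ} γj^{2^{k−i}} z^{2^{tj}} + z = 0 is z = 0. Define G(x) = x^{2^i} ((x + x^{2^k}) + ∑_{j=1}^{ρ} γj (x + x^{2^k})^{2^{tj}}). Then for every α ∈ F with α^{2^k} ≠ α and every nonzero λ in the subfield F_{2^k}, the Boolean function x ↦ Tr(λ α G(x)) is bent; that is, x ↦ α G(x) + (α G(x))^{2^k} is a vectorial bent function from F to F_{2^k}. -/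
open Finset

/-- The additive polynomial map `u ↦ u + ∑ j, c j * u ^ 2 ^ s j` in characteristic two. -/
noncomputable def linearizedMap {F ι : Type*} [Field F] [CharP F 2] [Fintype ι]
    (c : ι → F) (s : ι → ℕ) : F →+ F :=
  AddMonoidHom.id F +
    ∑ j, (AddMonoidHom.mulLeft (c j)).comp (iterateFrobenius F 2 (s j)).toAddMonoidHom

lemma linearizedMap_apply {F ι : Type*} [Field F] [CharP F 2] [Fintype ι]
    (c : ι → F) (s : ι → ℕ) (u : F) :
    linearizedMap c s u = u + ∑ j, c j * u ^ 2 ^ s j := by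
  simp [linearizedMap, iterateFrobenius_def]

lemma AddSubgroup.exists_apply_eq_of_injOn {F : Type*} [AddGroup F] [Finite F]
    (K : AddSubgroup F) (A : F →+ F) (hA : ∀ x ∈ K, A x ∈ K)
    (hinj : ∀ x ∈ K, A x = 0 → x = 0) {y : F} (hy : y ∈ K) : ∃ x ∈ K, A x = y := by
  let g : K →+ K := (A.comp K.subtype).codRestrict K fun x => hA x x.2
  have hg : Function.Injective g := by
    rw [injective_iff_map_eq_zero]
    intro x hx
    exact Subtype.ext (hinj x x.2 (congrArg Subtype.val hx))
  obtain ⟨x, hx⟩ := Finite.injective_iff_surjective.mp hg ⟨y, hy⟩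
  exact ⟨x, x.2, congrArg Subtype.val hx⟩

lemma neg_one_pow_val_add (a b : ZMod 2) :
    (-1 : ℤ) ^ (a + b).val = (-1) ^ a.val * (-1) ^ b.val := by
  revert a b; decide

lemma sum_neg_one_pow_val_eq_zero {V : Type*} [AddCommGroup V] [Fintype V]
    (g : V →+ ZMod 2) {v : V} (hv : g v ≠ 0) : ∑ x, (-1 : ℤ) ^ (g x).val = 0 := by
  have hv1 : (-1 : ℤ) ^ (g v).val = -1 := by
    revert hv; generalize g v = a; revert a; decide
  have h : ∑ x, (-1 : ℤ) ^ (g x).val = -∑ x, (-1 : ℤ) ^ (g x).val := by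
    conv_lhs => rw [← Equiv.sum_comp (Equiv.addRight v)]
    simp only [Equiv.coe_addRight, map_add, neg_one_pow_val_add, hv1, mul_neg, mul_one,
      sum_neg_distrib]
  linarith

/-- The sign sum of a quadratic function with nondegenerate polarization squares to the order
of the group. -/
lemma sum_neg_one_pow_val_sq {V : Type*} [AddCommGroup V] [Fintype V]
    (f : V → ZMod 2) (B : V → V →+ ZMod 2) (hf : ∀ x d, f (x + d) = f x + f d + B d x)
    (hB : ∀ d, (∀ x, B d x = 0) → d = 0) :
    (∑ x, (-1 : ℤ) ^ (f x).val) ^ 2 = Fintype.card V := by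
  classical
  have hinner (d : V) : ∑ x, (-1 : ℤ) ^ (f x).val * (-1) ^ (f (x + d)).val =
      if d = 0 then (Fintype.card V : ℤ) else 0 := by
    split_ifs with hd
    · simp [hd, ← neg_one_pow_val_add, CharTwo.add_self_eq_zero]
    · obtain ⟨v, hv⟩ : ∃ v, B d v ≠ 0 := by
        by_contra! h
        exact hd (hB d h)
      have hterm (x : V) : (-1 : ℤ) ^ (f x).val * (-1) ^ (f (x + d)).val =
          (-1) ^ (f d).val * (-1) ^ (B d x).val := by
        rw [← neg_one_pow_val_add, ← neg_one_pow_val_add, hf, ← add_assoc, ← add_assoc,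
          CharTwo.add_self_eq_zero, zero_add]
      rw [sum_congr rfl fun x _ => hterm x, ← mul_sum, sum_neg_one_pow_val_eq_zero _ hv, mul_zero]
  calc (∑ x, (-1 : ℤ) ^ (f x).val) ^ 2
      = ∑ x, ∑ d, (-1 : ℤ) ^ (f x).val * (-1) ^ (f (x + d)).val := by
        rw [sq, sum_mul_sum]
        refine sum_congr rfl fun x _ => ?_
        exact (Equiv.sum_comp (Equiv.addLeft x) fun y =>
          (-1 : ℤ) ^ (f x).val * (-1) ^ (f y).val).symm
    _ = Fintype.card V := by
        rw [sum_comm]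
        simp [hinner]

section SubfieldTrace

variable {F : Type*} [Field F] [CharP F 2] {k : ℕ}

/-- The elements of `F` fixed by `x ↦ x ^ 2 ^ k`, as a subfield. -/
def frobeniusFixed (F : Type*) [Field F] [CharP F 2] (k : ℕ) : Subfield F :=
  (iterateFrobenius F 2 k).eqLocusField (RingHom.id F)

lemma mem_frobeniusFixed {x : F} :
    x ∈ frobeniusFixed F k ↔ x ^ 2 ^ k = x :=
  Iff.rfl

lemma add_pow_mem_frobeniusFixed (hF : ∀ x : F, (x ^ 2 ^ k) ^ 2 ^ k = x) (x : F) :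
    x + x ^ 2 ^ k ∈ frobeniusFixed F k := by
  rw [mem_frobeniusFixed, add_pow_char_pow, hF, add_comm]

lemma add_pow_eq_zero_iff_mem_frobeniusFixed {x : F} :
    x + x ^ 2 ^ k = 0 ↔ x ∈ frobeniusFixed F k := by
  rw [CharTwo.add_eq_zero, mem_frobeniusFixed, eq_comm]

lemma add_pow_mul {y : F} (hy : y ∈ frobeniusFixed F k) (a : F) :
    a * y + (a * y) ^ 2 ^ k = (a + a ^ 2 ^ k) * y := by
  rw [mul_pow, mem_frobeniusFixed.mp hy, add_mul]

/-- The relative trace `x ↦ x + x ^ 2 ^ k` maps `F` onto the fixed subfield. -/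
lemma exists_add_pow_eq (hF : ∀ x : F, (x ^ 2 ^ k) ^ 2 ^ k = x) {a : F}
    (ha : a ∉ frobeniusFixed F k) {y : F} (hy : y ∈ frobeniusFixed F k) :
    ∃ z ∈ frobeniusFixed F k, a * z + (a * z) ^ 2 ^ k = y := by
  have h0 : a + a ^ 2 ^ k ≠ 0 := fun h => ha (add_pow_eq_zero_iff_mem_frobeniusFixed.mp h)
  have hz : y / (a + a ^ 2 ^ k) ∈ frobeniusFixed F k :=
    div_mem hy (add_pow_mem_frobeniusFixed hF a)
  exact ⟨_, hz, by rw [add_pow_mul hz, mul_div_cancel₀ _ h0]⟩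

lemma linearizedMap_mem {ι : Type*} [Fintype ι] {c : ι → F} (hc : ∀ j, c j ∈ frobeniusFixed F k)
    (s : ι → ℕ) {u : F} (hu : u ∈ frobeniusFixed F k) :
    linearizedMap c s u ∈ frobeniusFixed F k := by
  rw [linearizedMap_apply]
  exact add_mem hu (sum_mem fun j _ => mul_mem (hc j) (pow_mem hu _))

variable [Finite F] [Algebra (ZMod 2) F]

lemma trace_zmod_two_pow (x : F) (m : ℕ) :
    Algebra.trace (ZMod 2) F (x ^ 2 ^ m) = Algebra.trace (ZMod 2) F x := by
  induction m with
  | zero => simp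
  | succ m ih =>
    rw [pow_succ, pow_mul, ← ih]
    simpa using Algebra.trace_eq_of_algEquiv (FiniteField.frobeniusAlgEquiv (ZMod 2) F 2)
      (x ^ 2 ^ m)

lemma trace_eq_zero_of_mem_frobeniusFixed (hF : ∀ x : F, (x ^ 2 ^ k) ^ 2 ^ k = x) {a : F}
    (ha : a ∉ frobeniusFixed F k) {y : F} (hy : y ∈ frobeniusFixed F k) :
    Algebra.trace (ZMod 2) F y = 0 := by
  obtain ⟨z, -, rfl⟩ := exists_add_pow_eq hF ha hy
  rw [map_add, trace_zmod_two_pow, CharTwo.add_self_eq_zero]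

/-- For `a` outside the fixed subfield, `(y, w) ↦ Tr (a * y * w)` is nondegenerate on it. -/
lemma eq_zero_of_trace_mul_eq_zero (hF : ∀ x : F, (x ^ 2 ^ k) ^ 2 ^ k = x) {a : F}
    (ha : a ∉ frobeniusFixed F k) {w : F} (hw : w ∈ frobeniusFixed F k)
    (h : ∀ y ∈ frobeniusFixed F k, Algebra.trace (ZMod 2) F (a * (y * w)) = 0) : w = 0 := by
  refine (traceForm_nondegenerate (ZMod 2) F).1 w fun x => ?_
  obtain ⟨y, hy, hyx⟩ := exists_add_pow_eq hF ha (add_pow_mem_frobeniusFixed hF x)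
  have hmem : x + a * y ∈ frobeniusFixed F k := by
    rw [← add_pow_eq_zero_iff_mem_frobeniusFixed, add_pow_char_pow, add_add_add_comm, hyx,
      CharTwo.add_self_eq_zero]
  have h0 := trace_eq_zero_of_mem_frobeniusFixed hF ha (mul_mem hw hmem)
  rw [mul_add, map_add, mul_left_comm, mul_comm w y, h y hy, add_zero] at h0
  rwa [Algebra.traceForm_apply]

lemma trace_mul_pow_eq (hF : ∀ x : F, (x ^ 2 ^ k) ^ 2 ^ k = x) {b : F}
    (hb : b + b ^ 2 ^ k = 1) {s : F} (hs : s ∈ frobeniusFixed F k) (m : ℕ) :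
    Algebra.trace (ZMod 2) F (b * s ^ 2 ^ m) = Algebra.trace (ZMod 2) F (b * s) := by
  have hbK : b ∉ frobeniusFixed F k := fun h =>
    one_ne_zero (hb.symm.trans (add_pow_eq_zero_iff_mem_frobeniusFixed.mpr h))
  have hmem : b + b ^ 2 ^ m ∈ frobeniusFixed F k := by
    rw [← add_pow_eq_zero_iff_mem_frobeniusFixed, add_pow_char_pow, pow_right_comm,
      add_add_add_comm, hb, ← add_pow_char_pow, hb, one_pow, CharTwo.add_self_eq_zero]
  have h0 := trace_eq_zero_of_mem_frobeniusFixed hF hbK (mul_mem hmem (pow_mem hs (2 ^ m)))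
  rw [add_mul, map_add, ← mul_pow, trace_zmod_two_pow, CharTwo.add_eq_zero] at h0
  exact h0

/-- A linearized map is injective on the fixed subfield as soon as its adjoint is. -/
lemma linearizedMap_eq_zero_of_adjoint (hF : ∀ x : F, (x ^ 2 ^ k) ^ 2 ^ k = x) {a : F}
    (ha : a ∉ frobeniusFixed F k) {ι : Type*} [Fintype ι] {c : ι → F}
    (hc : ∀ j, c j ∈ frobeniusFixed F k) {s : ι → ℕ} (hs : ∀ j, s j ≤ k)
    (hadj : ∀ z ∈ frobeniusFixed F k,
      linearizedMap (fun j => c j ^ 2 ^ (k - s j)) (fun j => k - s j) z = 0 → z = 0)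
    {u : F} (hu : u ∈ frobeniusFixed F k) (h0 : linearizedMap c s u = 0) : u = 0 := by
  obtain ⟨z₁, -, hb⟩ := exists_add_pow_eq hF ha (one_mem (frobeniusFixed F k))
  set b := a * z₁
  have hbK : b ∉ frobeniusFixed F k := fun h =>
    one_ne_zero (hb.symm.trans (add_pow_eq_zero_iff_mem_frobeniusFixed.mpr h))
  refine eq_zero_of_trace_mul_eq_zero hF hbK hu fun y hy => ?_
  obtain ⟨z, hz, rfl⟩ := (frobeniusFixed F k).toAddSubgroup.exists_apply_eq_of_injOn
    (linearizedMap (fun j => c j ^ 2 ^ (k - s j)) (fun j => k - s j))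
    (fun x hx => linearizedMap_mem (fun j => pow_mem (hc j) _) _ hx) hadj hy
  have hterm (j : ι) : Algebra.trace (ZMod 2) F (b * (c j ^ 2 ^ (k - s j) * z ^ 2 ^ (k - s j) * u))
      = Algebra.trace (ZMod 2) F (b * (z * (c j * u ^ 2 ^ s j))) := by
    have hmem : z * (c j * u ^ 2 ^ s j) ∈ frobeniusFixed F k :=
      mul_mem hz (mul_mem (hc j) (pow_mem hu _))
    rw [← trace_mul_pow_eq hF hb hmem (k - s j)]
    congr 2
    rw [mul_pow, mul_pow, ← pow_mul, ← pow_add, Nat.add_sub_cancel' (hs j),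
      mem_frobeniusFixed.mp hu]
    ring
  have hz0 : Algebra.trace (ZMod 2) F (b * (z * linearizedMap c s u)) = 0 := by
    rw [h0, mul_zero, mul_zero, map_zero]
  rw [← hz0]
  simp only [linearizedMap_apply, add_mul, mul_add, sum_mul, mul_sum, map_add, map_sum, hterm]

end SubfieldTrace

theorem stmt_12 (k : ℕ) (hk : 1 ≤ k) (i ρ : ℕ) (hρ1 : 1 ≤ ρ) (hρk : ρ ≤ k)
    (t : Fin ρ → ℕ) (ht : ∀ j, t j ≤ k)
    (γ : Fin ρ → GaloisField 2 (2 * k)) (hγ : ∀ j, (γ j) ^ 2 ^ k = γ j)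
    (h1 : ∀ z : GaloisField 2 (2 * k), z ^ 2 ^ k = z →
      (∑ j, (γ j) ^ 2 ^ (k - t j) * z ^ 2 ^ (k - t j)) + z = 0 → z = 0)
    (h2 : ∀ z : GaloisField 2 (2 * k), z ^ 2 ^ k = z →
      (∑ j, (γ j) ^ 2 ^ (k - i) * z ^ 2 ^ (t j)) + z = 0 → z = 0)
    (G : GaloisField 2 (2 * k) → GaloisField 2 (2 * k))
    (hGdef : ∀ x, G x = x ^ 2 ^ i *
        ((x + x ^ 2 ^ k) + ∑ j, γ j * (x + x ^ 2 ^ k) ^ 2 ^ (t j)))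
    (α : GaloisField 2 (2 * k)) (hα : α ^ 2 ^ k ≠ α) :
    ∀ lam : GaloisField 2 (2 * k), lam ^ 2 ^ k = lam → lam ≠ 0 →
      IsBent (fun x => gTr (2 * k) (lam * (α * G x))) := by
  intro lam hlam hlam0
  have hcard : Fintype.card (GaloisField 2 (2 * k)) = 2 ^ (2 * k) := by
    rw [← Nat.card_eq_fintype_card, GaloisField.card 2 (2 * k) (by omega)]
  have hF (x : GaloisField 2 (2 * k)) : (x ^ 2 ^ k) ^ 2 ^ k = x := by
    rw [← pow_mul, ← pow_add, ← two_mul, ← hcard, FiniteField.pow_card]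
  set K := frobeniusFixed (GaloisField 2 (2 * k)) k
  have ha : lam * α ∉ K := fun h => hα <| mem_frobeniusFixed.mp <| by
    simpa [hlam0] using mul_mem (inv_mem (mem_frobeniusFixed.mpr hlam : lam ∈ K)) h
  set a := lam * α
  set A := linearizedMap γ t
  have hAK : ∀ u ∈ K, A u ∈ K := fun u hu => linearizedMap_mem hγ t hu
  have hA : ∀ u ∈ K, A u = 0 → u = 0 := fun u hu h0 =>
    linearizedMap_eq_zero_of_adjoint hF ha hγ ht
      (fun z hz h => h1 z hz (by rwa [linearizedMap_apply, add_comm] at h)) hu h0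
  let T : GaloisField 2 (2 * k) →+ GaloisField 2 (2 * k) :=
    AddMonoidHom.id _ + (iterateFrobenius _ 2 k).toAddMonoidHom
  have hT (x) : T x = x + x ^ 2 ^ k := by simp [T, iterateFrobenius_def]
  have hTK (x) : T x ∈ K := by rw [hT]; exact add_pow_mem_frobeniusFixed hF x
  have hT0 {x} : T x = 0 ↔ x ∈ K := by rw [hT, add_pow_eq_zero_iff_mem_frobeniusFixed]
  let P : GaloisField 2 (2 * k) →+ GaloisField 2 (2 * k) :=
    (iterateFrobenius _ 2 i).toAddMonoidHom
  have hP (x) : P x = x ^ 2 ^ i := by simp [P, iterateFrobenius_def]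
  have hPK : ∀ x ∈ K, P x ∈ K := fun x hx => by rw [hP]; exact pow_mem hx _
  have hP0 : ∀ x ∈ K, P x = 0 → x = 0 := fun x _ h => by
    rw [hP] at h; exact eq_zero_of_pow_eq_zero h
  let Tr : GaloisField 2 (2 * k) →+ ZMod 2 := (Algebra.trace (ZMod 2) _).toAddMonoidHom
  have hG (x) : lam * (α * G x) = a * (P x * A (T x)) := by
    rw [hGdef, hP, hT, linearizedMap_apply, mul_assoc]
  let B (d : GaloisField 2 (2 * k)) : GaloisField 2 (2 * k) →+ ZMod 2 :=
    Tr.comp ((AddMonoidHom.mulLeft a).comp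
      ((AddMonoidHom.mulRight (A (T d))).comp P +
        (AddMonoidHom.mulLeft (P d)).comp (A.comp T)))
  have hB (d x) : B d x = Tr (a * (P x * A (T d) + P d * A (T x))) := rfl
  intro μ
  have hcard' : (2 : ℤ) ^ (2 * k) = Fintype.card (GaloisField 2 (2 * k)) := by simp [hcard]
  rw [hcard']
  refine sum_neg_one_pow_val_sq _ B (fun x d => ?_) fun d hd => ?_
  · change Tr _ + Tr _ = Tr _ + Tr _ + (Tr _ + Tr _) + B d x
    simp only [hG, hB, map_add, mul_add, add_mul]
    abel
  · have hdK : d ∈ K := by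
      refine hT0.mp (hA _ (hTK d) (eq_zero_of_trace_mul_eq_zero hF ha (hAK _ (hTK d)) ?_))
      intro y hy
      obtain ⟨x, hx, rfl⟩ := K.toAddSubgroup.exists_apply_eq_of_injOn P hPK hP0 hy
      have h := hd x
      rwa [hB, hT0.mpr hx, map_zero, mul_zero, add_zero] at h
    refine hP0 d hdK (eq_zero_of_trace_mul_eq_zero hF ha (hPK d hdK) fun y hy => ?_)
    obtain ⟨v, hv, rfl⟩ := K.toAddSubgroup.exists_apply_eq_of_injOn A hAK hA hy
    obtain ⟨z, -, hz⟩ := exists_add_pow_eq hF ha hv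
    have h := hd (a * z)
    rwa [hB, hT0.mpr hdK, map_zero, mul_zero, zero_add, hT, hz, mul_comm (P d)] at h
end
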